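/- arXiv:2407.04626 — 2 statements merged into one kernel-verified Lean document; each statement's English description precedes it below -/
import Mathlib

section
/- Fix d, s ≥ 1, b ≥ 1, and polynomials f_1,…,f_m ∈ ℚ[x_{11},…,x_{dd}] in d² variables of total degree at most b, and let Z := {A ∈ GL_d(ℚ̄) : f_1(A) = ⋯ = f_m(A) = 0}. Then there exist pairwise commuting semisimple matrices M_1,…,M_s ∈ GL_d(ℚ̄) (not necessarily distinct) with Z = cl⟨M_1,…,M_s⟩ if and only if there exist P ∈ GL_d(ℚ̄) and a subgroup Λ ⊆ ℤ^d generated by vectors of supremum norm at most b, whose quotient ℤ^d/Λ has torsion subgroup generated by at most s elements, such that P⁻¹ZP = {Δ(g) : g ∈ H_Λ}. -/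
open Matrix MvPolynomial

noncomputable section

abbrev Qbar : Type := AlgebraicClosure ℚ

/-- Zariski closure of a subset of `Qbar^ι`: the common zero set of all polynomials
vanishing on `E`. -/
def zcl {ι : Type} [Fintype ι] (E : Set (ι → Qbar)) : Set (ι → Qbar) :=
  {x | ∀ p : MvPolynomial ι Qbar, (∀ y ∈ E, eval y p = 0) → eval x p = 0}

/-- Zariski closure of a set of `d × d` matrices over `Qbar` (matrices identified with
points of `Qbar^(d²)`). -/
def mcl {d : ℕ} (E : Set (Matrix (Fin d) (Fin d) Qbar)) : Set (Matrix (Fin d) (Fin d) Qbar) :=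
  {A | ∀ p : MvPolynomial (Fin d × Fin d) Qbar,
      (∀ B ∈ E, eval (fun ij => B ij.1 ij.2) p = 0) → eval (fun ij => A ij.1 ij.2) p = 0}

/-- `cl⟨S⟩`: the group topologically generated by `S ⊆ GL_d(Qbar)`, i.e.
`GL_d(Qbar) ∩ cl(⟨S⟩)` where `⟨S⟩` is the subgroup generated by `S`. -/
def topcl {d : ℕ} (S : Set (GL (Fin d) Qbar)) : Set (GL (Fin d) Qbar) :=
  {g | (g : Matrix (Fin d) (Fin d) Qbar) ∈
      mcl ((fun h : GL (Fin d) Qbar => (h : Matrix (Fin d) (Fin d) Qbar)) ''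
        ((Subgroup.closure S : Subgroup (GL (Fin d) Qbar)) : Set (GL (Fin d) Qbar)))}

/-- A matrix `M` is semisimple if it is diagonalisable over `Qbar`. -/
def IsSemisimpleM {d : ℕ} (M : Matrix (Fin d) (Fin d) Qbar) : Prop :=
  ∃ P : GL (Fin d) Qbar, ∃ D : Fin d → Qbar,
    M = ((P⁻¹ : GL (Fin d) Qbar) : Matrix (Fin d) (Fin d) Qbar) * Matrix.diagonal D *
      (P : Matrix (Fin d) (Fin d) Qbar)

/-- `H_Λ = {x ∈ (Qbarˣ)^d : x₁^{v₁} ⋯ x_d^{v_d} = 1 for all v ∈ Λ}`. -/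
def HLat {d : ℕ} (Λ : Submodule ℤ (Fin d → ℤ)) : Set (Fin d → Qbarˣ) :=
  {x | ∀ v ∈ Λ, ∏ i, x i ^ v i = 1}


section Duality

lemma eq_zero_of_prod_primes_zpow_eq_one {n : ℕ} (e : Fin n → ℤ)
    (h : ∏ k : Fin n, ((Nat.nth Nat.Prime k : ℕ) : ℚ) ^ e k = 1) : e = 0 := by
  have hp : ∀ k, Nat.Prime (Nat.nth Nat.Prime k) := Nat.prime_nth_prime
  funext k
  have : Fact (Nat.Prime (Nat.nth Nat.Prime k)) := ⟨hp k⟩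
  have key : ∀ t : Finset (Fin n),
      padicValRat (Nat.nth Nat.Prime k) (∏ l ∈ t, ((Nat.nth Nat.Prime l : ℕ) : ℚ) ^ e l) =
        ∑ l ∈ t, if l = k then e l else 0 := by
    intro t
    induction t using Finset.induction_on with
    | empty => simp
    | insert a t ha ih =>
      have h0 : ∀ l : Fin n, ((Nat.nth Nat.Prime l : ℕ) : ℚ) ^ e l ≠ 0 := fun l =>
        zpow_ne_zero _ (Nat.cast_ne_zero.2 (hp l).ne_zero)
      rw [Finset.prod_insert ha, Finset.sum_insert ha,
        padicValRat.mul (h0 a) (Finset.prod_ne_zero_iff.2 fun l _ => h0 l), ih, padicValRat.zpow]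
      congr 1
      split_ifs with hak
      · subst hak
        simp [padicValRat.of_nat]
      · have : Fact (Nat.Prime (Nat.nth Nat.Prime a)) := ⟨hp a⟩
        have hne : Nat.nth Nat.Prime k ≠ Nat.nth Nat.Prime a := fun hh =>
          hak (Fin.ext (Nat.nth_injective Nat.infinite_setOfPred_prime hh)).symm
        rw [padicValRat.of_nat, padicValNat_primes hne]
        simp
  have := key Finset.univ
  rw [h] at this
  simpa using this.symm

instance finite_torsion_int (A : Type*) [AddCommGroup A] [Module.Finite ℤ A] :
    Finite (Submodule.torsion ℤ A) :=
  Module.finite_of_fg_torsion _ Submodule.torsion_isTorsion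

/-- A torsion-free finitely generated group embeds into the units of `Qbar`, in such a way that
nonzero elements have infinite order. -/
lemma exists_hom_units_of_torsionFree (Q : Type*) [AddCommGroup Q] [Module.Finite ℤ Q]
    [Module.IsTorsionFree ℤ Q] :
    ∃ ψ : Q →+ Additive Qbarˣ, ∀ q, ∀ N : ℕ, N ≠ 0 → N • ψ q = 0 → q = 0 := by
  have : Module.Free ℤ Q := Module.free_of_finite_type_torsion_free'
  obtain ⟨n, ⟨c⟩⟩ : ∃ n, Nonempty (Module.Basis (Fin n) ℤ Q) :=
    ⟨_, ⟨Module.finBasis ℤ Q⟩⟩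
  have hp : ∀ k, Nat.Prime (Nat.nth Nat.Prime k) := Nat.prime_nth_prime
  let pr : Fin n → Qbarˣ := fun k =>
    Units.mk0 (((Nat.nth Nat.Prime k : ℕ)) : Qbar) (Nat.cast_ne_zero.2 (hp k).ne_zero)
  let ψ : Q →ₗ[ℤ] Additive Qbarˣ := c.constr ℤ fun k => Additive.ofMul (pr k)
  refine ⟨ψ.toAddMonoidHom, fun q N hN h => ?_⟩
  have h1 : ψ (N • q) = 0 := by rw [map_nsmul]; exact h
  rw [Module.Basis.constr_apply_fintype] at h1
  have h2 : ∏ k, pr k ^ (c.equivFun (N • q) k) = 1 := by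
    have := congrArg Additive.toMul h1
    simpa using this
  have h3 : ((∏ k : Fin n, ((Nat.nth Nat.Prime k : ℕ) : ℚ) ^ (c.equivFun (N • q) k) : ℚ) : Qbar) = 1 := by
    have := congrArg (fun u : Qbarˣ => (u : Qbar)) h2
    push_cast at this ⊢
    simpa [pr] using this
  have h4 := eq_zero_of_prod_primes_zpow_eq_one _ (by exact_mod_cast h3)
  have h5 : N • q = 0 := c.equivFun.map_eq_zero_iff.1 h4
  rw [← natCast_zsmul] at h5
  exact (smul_eq_zero.1 h5).resolve_left (by exact_mod_cast hN)

/-- If the finite group `T` is generated by `s` elements, then `s` characters separate its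
points. -/
lemma exists_separating_characters_of_finite {T : Type*} [AddCommGroup T] [Finite T] {s : ℕ}
    (t : Fin s → T) (ht : Submodule.span ℤ (Set.range t) = ⊤) :
    ∃ φ : Fin s → (T →+ Additive Qbarˣ), ∀ x, (∀ j, φ j x = 0) → x = 0 := by
  obtain ⟨e⟩ := CommGroup.monoidHom_mulEquiv_of_hasEnoughRootsOfUnity (Multiplicative T) Qbar
  refine ⟨fun j => MonoidHom.toAdditiveRight (e.symm (Multiplicative.ofAdd (t j))), fun x hx => ?_⟩
  have h1 : ∀ y : T, e.symm (Multiplicative.ofAdd y) (Multiplicative.ofAdd x) = 1 := by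
    intro y
    have hy : y ∈ Submodule.span ℤ (Set.range t) := by rw [ht]; trivial
    induction hy using Submodule.span_induction with
    | mem y hy =>
      obtain ⟨j, rfl⟩ := hy
      exact hx j
    | zero => simp
    | add y z _ _ hy hz => simp [ofAdd_add, hy, hz]
    | smul a y _ hy => simp [ofAdd_zsmul, hy]
  by_contra hne
  obtain ⟨χ, hχ⟩ := CommGroup.exists_apply_ne_one_of_hasEnoughRootsOfUnity (Multiplicative T) Qbar
    (a := Multiplicative.ofAdd x) (by simpa using hne)
  apply hχ
  simpa using h1 (Multiplicative.toAdd (e χ))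

lemma exists_separating_characters {A : Type*} [AddCommGroup A] [Module.Finite ℤ A] {s : ℕ}
    (hs : 1 ≤ s) (t : Fin s → Submodule.torsion ℤ A)
    (ht : Submodule.span ℤ (Set.range t) = ⊤) :
    ∃ Φ : Fin s → (A →+ Additive Qbarˣ), ∀ a, (∀ j, Φ j a = 0) → a = 0 := by
  obtain ⟨φ, hφ⟩ := exists_separating_characters_of_finite t ht
  obtain ⟨ψ, hψ⟩ := exists_hom_units_of_torsionFree (A ⧸ Submodule.torsion ℤ A)
  have : Module.Free ℤ (A ⧸ Submodule.torsion ℤ A) := Module.free_of_finite_type_torsion_free'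
  let π := (Submodule.torsion ℤ A).mkQ
  obtain ⟨σ, hσ⟩ := Module.projective_lifting_property π LinearMap.id
    (Submodule.mkQ_surjective _)
  have hσ' : ∀ q, π (σ q) = q := fun q => LinearMap.congr_fun hσ q
  let r : A →ₗ[ℤ] Submodule.torsion ℤ A :=
    (LinearMap.id - σ.comp π).codRestrict _ (fun a => by
      refine (Submodule.Quotient.mk_eq_zero _).1 ?_
      change π (a - σ (π a)) = 0
      rw [map_sub, hσ', sub_self])
  let j₀ : Fin s := ⟨0, hs⟩
  refine ⟨fun j => (φ j).comp r.toAddMonoidHom +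
    if j = j₀ then ψ.comp π.toAddMonoidHom else 0, fun a ha => ?_⟩
  have ha' : ∀ j, φ j (r a) + (if j = j₀ then ψ (π a) else 0) = 0 := by
    intro j
    have := ha j
    split_ifs with h <;> simpa [h] using this
  have hπ : π a = 0 := by
    refine hψ _ (Nat.card (Submodule.torsion ℤ A)) Nat.card_pos.ne' ?_
    have h0 := ha' j₀
    rw [if_pos rfl] at h0
    have h1 : Nat.card (Submodule.torsion ℤ A) • φ j₀ (r a) = 0 := by
      rw [← map_nsmul, card_nsmul_eq_zero', map_zero]
    rw [eq_neg_of_add_eq_zero_right h0, neg_nsmul, h1, neg_zero]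
  have hr : r a = 0 := hφ _ fun j => by
    have := ha' j
    simpa [hπ] using this
  have : (r a : A) = a - σ (π a) := rfl
  rw [hr, hπ] at this
  simpa using this.symm

lemma exists_generators_torsion {A : Type*} [AddCommGroup A] [Module.Finite ℤ A] {s : ℕ}
    (Φ : Fin s → (A →+ Additive Qbarˣ)) (hΦ : ∀ a, (∀ j, Φ j a = 0) → a = 0) :
    ∃ t : Fin s → Submodule.torsion ℤ A, Submodule.span ℤ (Set.range t) = ⊤ := by
  let N := Nat.card (Submodule.torsion ℤ A)
  have : NeZero N := ⟨Nat.card_pos.ne'⟩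
  obtain ⟨ζ, hζ⟩ := HasEnoughRootsOfUnity.exists_primitiveRoot Qbar N
  obtain ⟨ζ, rfl⟩ := hζ.isUnit (NeZero.ne N)
  have hζ' : IsPrimitiveRoot ζ N := IsPrimitiveRoot.coe_units_iff.1 hζ
  let h : (Fin s → ℤ) →ₗ[ℤ] (Fin s → Additive Qbarˣ) :=
    LinearMap.pi fun j => (LinearMap.toSpanSingleton ℤ _ (Additive.ofMul ζ)).comp (LinearMap.proj j)
  let F : Submodule.torsion ℤ A →ₗ[ℤ] (Fin s → Additive Qbarˣ) :=
    LinearMap.pi fun j => (Φ j).toIntLinearMap.comp (Submodule.subtype _)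
  have hF : Function.Injective F := by
    rw [injective_iff_map_eq_zero]
    intro a ha
    exact Subtype.ext (hΦ _ fun j => congrFun ha j)
  have hFh : LinearMap.range F ≤ LinearMap.range h := by
    rintro _ ⟨a, rfl⟩
    have : ∀ j, ∃ k : ℤ, k • Additive.ofMul ζ = Φ j a := by
      intro j
      have h1 : (Additive.toMul (Φ j a)) ∈ rootsOfUnity N Qbar := by
        rw [mem_rootsOfUnity]
        have h2 : N • a = 0 := card_nsmul_eq_zero'
        have h3 : N • Φ j (a : A) = 0 := by
          rw [← map_nsmul, ← AddSubmonoidClass.coe_nsmul, h2]; simp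
        exact congrArg Additive.toMul h3
      rw [← hζ'.zpowers_eq] at h1
      obtain ⟨k, hk⟩ := h1
      exact ⟨k, congrArg Additive.ofMul hk⟩
    choose k hk using this
    exact ⟨k, funext hk⟩
  let W := (LinearMap.range F).comap h
  obtain ⟨n, ⟨b⟩⟩ := Submodule.nonempty_basis_of_pid (Pi.basisFun ℤ (Fin s)) W
  have hn : n ≤ s := by
    have h1 := Submodule.finrank_le W
    rw [Module.finrank_eq_card_basis b, Module.finrank_eq_card_basis (Pi.basisFun ℤ (Fin s))] at h1
    simpa using h1
  let w : Fin s → W := fun j => if hj : (j : ℕ) < n then b ⟨j, hj⟩ else 0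
  have hw : Submodule.span ℤ (Set.range w) = ⊤ := by
    rw [eq_top_iff, ← b.span_eq, Submodule.span_le]
    rintro _ ⟨k, rfl⟩
    refine Submodule.subset_span ⟨⟨k, k.2.trans_le hn⟩, ?_⟩
    simp [w]
  have ht : ∀ j, ∃ a, F a = h (w j) := fun j => (w j).2
  choose t ht using ht
  refine ⟨t, ?_⟩
  apply Submodule.map_injective_of_injective hF
  rw [Submodule.map_span, ← Set.range_comp, Submodule.map_top]
  have h1 : F ∘ t = (h.comp W.subtype) ∘ w := funext ht
  rw [h1, Set.range_comp, ← Submodule.map_span, hw, Submodule.map_top, LinearMap.range_comp,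
    Submodule.range_subtype, Submodule.map_comap_eq]
  exact inf_eq_right.2 hFh

end Duality

section Characters

/-- The character of the torus given by the exponent vector `v`. -/
def torusChar {d : ℕ} (x : Fin d → Qbarˣ) : (Fin d → ℤ) →+ Additive Qbarˣ where
  toFun v := Additive.ofMul (∏ i, x i ^ v i)
  map_zero' := by simp
  map_add' v w := by simp [_root_.zpow_add, Finset.prod_mul_distrib]

lemma mem_HLat_iff {d : ℕ} {Λ : Submodule ℤ (Fin d → ℤ)} {x : Fin d → Qbarˣ} :
    x ∈ HLat Λ ↔ ∀ v ∈ Λ, torusChar x v = 0 := Iff.rfl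

lemma exists_points_defining_lattice {d s : ℕ} (hs : 1 ≤ s) (Λ : Submodule ℤ (Fin d → ℤ))
    (t : Fin s → Submodule.torsion ℤ ((Fin d → ℤ) ⧸ Λ))
    (ht : Submodule.span ℤ (Set.range t) = ⊤) :
    ∃ g : Fin s → Fin d → Qbarˣ, ∀ v, v ∈ Λ ↔ ∀ j, torusChar (g j) v = 0 := by
  obtain ⟨Φ, hΦ⟩ := exists_separating_characters hs t ht
  refine ⟨fun j i => Additive.toMul (Φ j (Λ.mkQ (Pi.single i 1))), fun v => ?_⟩
  have key : ∀ j, torusChar (fun i => Additive.toMul (Φ j (Λ.mkQ (Pi.single i 1)))) v =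
      Φ j (Λ.mkQ v) := by
    intro j
    conv_rhs => rw [pi_eq_sum_univ' v]
    change (Additive.ofMul (∏ i, Additive.toMul (Φ j (Λ.mkQ (Pi.single i 1))) ^ v i)) = _
    rw [ofMul_prod]
    simp only [ofMul_zpow, ofMul_toMul, map_sum, map_zsmul]
  simp only [key]
  rw [← Submodule.Quotient.mk_eq_zero]
  exact ⟨fun h j => by rw [Submodule.mkQ_apply, h, map_zero], fun h => hΦ _ h⟩

lemma exists_generators_torsion_quotient {d s : ℕ} (Λ : Submodule ℤ (Fin d → ℤ))
    (g : Fin s → Fin d → Qbarˣ) (hg : ∀ v, v ∈ Λ ↔ ∀ j, torusChar (g j) v = 0) :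
    ∃ t : Fin s → Submodule.torsion ℤ ((Fin d → ℤ) ⧸ Λ),
      Submodule.span ℤ (Set.range t) = ⊤ := by
  refine exists_generators_torsion
    (fun j => (Λ.liftQ (torusChar (g j)).toIntLinearMap fun v hv => (hg v).1 hv j).toAddMonoidHom)
    fun a ha => ?_
  obtain ⟨v, rfl⟩ := Submodule.mkQ_surjective _ a
  exact (Submodule.Quotient.mk_eq_zero _).2 ((hg v).2 ha)

/-- A lattice is determined by its annihilator in the torus. -/
lemma mem_of_forall_mem_HLat {d : ℕ} {Λ : Submodule ℤ (Fin d → ℤ)} {v : Fin d → ℤ}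
    (h : ∀ x ∈ HLat Λ, torusChar x v = 0) : v ∈ Λ := by
  obtain ⟨n, t, ht⟩ := Submodule.fg_iff_exists_fin_generating_family.1
    (Module.Finite.fg_top (R := ℤ) (M := Submodule.torsion ℤ ((Fin d → ℤ) ⧸ Λ)))
  obtain ⟨g, hg⟩ := exists_points_defining_lattice (s := n + 1) (by omega) Λ (Fin.cons 0 t) (by
    rw [eq_top_iff, ← ht]
    refine Submodule.span_mono ?_
    rintro _ ⟨k, rfl⟩
    exact ⟨k.succ, by simp⟩)
  exact (hg v).2 fun j => h _ fun w hw => (hg w).1 hw j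

/-- A natural exponent vector, as an integral one. -/
def expVec {d : ℕ} (α : Fin d →₀ ℕ) : Fin d → ℤ := fun i => α i

lemma coe_torusChar_expVec {d : ℕ} (x : Fin d → Qbarˣ) (α : Fin d →₀ ℕ) :
    ((Additive.toMul (torusChar x (expVec α)) : Qbarˣ) : Qbar) = ∏ i, (x i : Qbar) ^ α i := by
  simp [torusChar, expVec]

lemma eval_torus {d : ℕ} (p : MvPolynomial (Fin d) Qbar) (x : Fin d → Qbarˣ) :
    eval (fun i => (x i : Qbar)) p =
      ∑ α ∈ p.support, coeff α p * (Additive.toMul (torusChar x (expVec α)) : Qbarˣ) := by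
  rw [MvPolynomial.eval_eq']
  simp only [coe_torusChar_expVec]

/-- A monomial restricted to a group of points of the torus. -/
def restrictedChar {d : ℕ} (G : Subgroup (Fin d → Qbarˣ)) (α : Fin d →₀ ℕ) : G →* Qbar where
  toFun x := ∏ i, ((x : Fin d → Qbarˣ) i : Qbar) ^ α i
  map_one' := by simp
  map_mul' x y := by simp [mul_pow, Finset.prod_mul_distrib]

/-- A polynomial that vanishes on a subgroup `G` of the torus vanishes on `H_Λ` as soon as `Λ`
contains all differences of exponents of the polynomial that are trivial on `G`. -/
lemma eval_eq_zero_of_mem_HLat {d : ℕ} (G : Subgroup (Fin d → Qbarˣ))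
    (p : MvPolynomial (Fin d) Qbar) (hp : ∀ x ∈ G, eval (fun i => (x i : Qbar)) p = 0)
    (Λ : Submodule ℤ (Fin d → ℤ))
    (hΛ : ∀ α ∈ p.support, ∀ β ∈ p.support,
      (∀ x ∈ G, torusChar x (expVec α - expVec β) = 0) → expVec α - expVec β ∈ Λ)
    {x : Fin d → Qbarˣ} (hx : x ∈ HLat Λ) : eval (fun i => (x i : Qbar)) p = 0 := by
  classical
  let χ := restrictedChar G
  let I := p.support.image χ
  have hmaps : ∀ α ∈ p.support, χ α ∈ I := fun α hα => Finset.mem_image_of_mem _ hα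
  have hsum : ∑ φ ∈ I, (∑ α ∈ p.support with χ α = φ, coeff α p) • (φ : G → Qbar) = 0 := by
    funext y
    have := hp y y.2
    rw [MvPolynomial.eval_eq', ← Finset.sum_fiberwise_of_maps_to hmaps] at this
    simp only [Finset.sum_apply, Pi.smul_apply, smul_eq_mul, Pi.zero_apply]
    rw [← this]
    refine Finset.sum_congr rfl fun φ _ => ?_
    rw [Finset.sum_mul]
    refine Finset.sum_congr rfl fun α hα => ?_
    rw [← (Finset.mem_filter.1 hα).2]
    rfl
  have hzero := linearIndependent_iff'.1 (linearIndependent_monoidHom G Qbar) I _ hsum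
  rw [eval_torus, ← Finset.sum_fiberwise_of_maps_to hmaps]
  refine Finset.sum_eq_zero fun φ hφ => ?_
  obtain ⟨β, hβ, rfl⟩ := Finset.mem_image.1 hφ
  have : ∀ α ∈ p.support.filter (χ · = χ β),
      coeff α p * ((Additive.toMul (torusChar x (expVec α)) : Qbarˣ) : Qbar) =
      coeff α p * ((Additive.toMul (torusChar x (expVec β)) : Qbarˣ) : Qbar) := by
    intro α hα
    obtain ⟨hα, hαβ⟩ := Finset.mem_filter.1 hα
    have h1 : expVec α - expVec β ∈ Λ := hΛ α hα β hβ fun y hy => by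
      rw [map_sub, sub_eq_zero]
      apply Additive.toMul.injective
      apply Units.ext
      rw [coe_torusChar_expVec, coe_torusChar_expVec]
      exact DFunLike.congr_fun hαβ ⟨y, hy⟩
    have h2 := hx _ h1
    have h3 : torusChar x (expVec α - expVec β) = 0 := h2
    rw [map_sub, sub_eq_zero] at h3
    rw [h3]
  rw [Finset.sum_congr rfl this, ← Finset.sum_mul, hzero _ hφ, zero_mul]

end Characters

section Matrices

/-- The diagonal torus in `GL_d`. -/
def diagGL {d : ℕ} : (Fin d → Qbarˣ) →* GL (Fin d) Qbar :=
  (Units.map (Matrix.diagonalRingHom (Fin d) Qbar).toMonoidHom).comp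
    MulEquiv.piUnits.symm.toMonoidHom

lemma coe_diagGL {d : ℕ} (x : Fin d → Qbarˣ) :
    (diagGL x : Matrix (Fin d) (Fin d) Qbar) = Matrix.diagonal (fun i => (x i : Qbar)) := rfl

lemma eval_conj {d : ℕ} (C D A : Matrix (Fin d) (Fin d) Qbar)
    (p : MvPolynomial (Fin d × Fin d) Qbar) :
    eval (fun ij : Fin d × Fin d => A ij.1 ij.2) (aeval (fun ij : Fin d × Fin d =>
        ∑ l, (∑ k, MvPolynomial.C (C ij.1 k) * X (k, l)) * MvPolynomial.C (D l ij.2)) p) =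
      eval (fun ij : Fin d × Fin d => (C * A * D) ij.1 ij.2) p := by
  rw [← MvPolynomial.coe_aeval_eq_eval, ← MvPolynomial.coe_aeval_eq_eval]
  simp only [RingHom.coe_coe]
  rw [MvPolynomial.comp_aeval_apply]
  congr 1
  congr 1
  funext ij
  simp [Matrix.mul_apply]

lemma conj_mem_topcl {d : ℕ} {S : Set (GL (Fin d) Qbar)} {A : GL (Fin d) Qbar}
    (P : GL (Fin d) Qbar) (hA : A ∈ topcl S) : P * A * P⁻¹ ∈ topcl (MulAut.conj P '' S) := by
  intro p hp
  rw [Units.val_mul, Units.val_mul, ← eval_conj]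
  apply hA
  rintro _ ⟨B, hB, rfl⟩
  rw [eval_conj, ← Units.val_mul, ← Units.val_mul]
  apply hp
  refine ⟨P * B * P⁻¹, ?_, rfl⟩
  have := Subgroup.mem_map_of_mem (MulAut.conj P).toMonoidHom hB
  rw [MonoidHom.map_closure] at this
  exact this

lemma mem_topcl_conj_iff {d : ℕ} {ι : Type*} (N : ι → GL (Fin d) Qbar) (P A : GL (Fin d) Qbar) :
    P * A * P⁻¹ ∈ topcl (Set.range fun j => P * N j * P⁻¹) ↔ A ∈ topcl (Set.range N) := by
  constructor
  · intro h
    have := conj_mem_topcl P⁻¹ h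
    rw [← Set.range_comp] at this
    convert this using 1
    · congr 2
      funext j
      simp only [Function.comp, MulAut.conj_apply]
      group
    · group
  · intro h
    have := conj_mem_topcl P h
    rwa [← Set.range_comp] at this

lemma eval_diagonal {d : ℕ} (a : Fin d → Qbar) (p : MvPolynomial (Fin d × Fin d) Qbar) :
    eval a (aeval (fun ij : Fin d × Fin d =>
        if ij.1 = ij.2 then (X ij.1 : MvPolynomial (Fin d) Qbar) else 0) p) =
      eval (fun ij : Fin d × Fin d => Matrix.diagonal a ij.1 ij.2) p := by
  rw [← MvPolynomial.coe_aeval_eq_eval, ← MvPolynomial.coe_aeval_eq_eval]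
  simp only [RingHom.coe_coe]
  rw [MvPolynomial.comp_aeval_apply]
  congr 1
  congr 1
  funext ij
  by_cases h : ij.1 = ij.2 <;> simp [h]

lemma torusChar_closure_eq_zero {d : ℕ} {ι : Type*} {g : ι → Fin d → Qbarˣ} {v : Fin d → ℤ}
    (h : ∀ j, torusChar (g j) v = 0) {x : Fin d → Qbarˣ}
    (hx : x ∈ Subgroup.closure (Set.range g)) : torusChar x v = 0 := by
  change Additive.ofMul (∏ i, x i ^ v i) = 0
  rw [ofMul_eq_zero]
  induction hx using Subgroup.closure_induction with
  | mem x hx =>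
    obtain ⟨j, rfl⟩ := hx
    exact h j
  | one => simp
  | mul x y _ _ hx hy => simp [mul_zpow, Finset.prod_mul_distrib, hx, hy]
  | inv x _ hx => simp [hx]

lemma topcl_diagGL {d : ℕ} {ι : Type*} (g : ι → Fin d → Qbarˣ) (Λ : Submodule ℤ (Fin d → ℤ))
    (hg : ∀ v, v ∈ Λ ↔ ∀ j, torusChar (g j) v = 0) :
    topcl (Set.range fun j => diagGL (g j)) = {A : GL (Fin d) Qbar | ∃ x ∈ HLat Λ,
      (A : Matrix (Fin d) (Fin d) Qbar) = Matrix.diagonal (fun i => (x i : Qbar))} := by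
  have hcl : Subgroup.closure (Set.range fun j => diagGL (g j)) =
      (Subgroup.closure (Set.range g)).map diagGL := by
    rw [MonoidHom.map_closure, ← Set.range_comp]; rfl
  ext A
  simp only [topcl, hcl, Set.mem_ofPred_eq]
  constructor
  · intro hA
    have hoff : (A : Matrix (Fin d) (Fin d) Qbar) =
        Matrix.diagonal (fun i => (A : Matrix (Fin d) (Fin d) Qbar) i i) := by
      ext i j
      rw [Matrix.diagonal_apply]
      split_ifs with hij
      · rw [hij]
      · have := hA (X (i, j)) (by
          rintro _ ⟨_, ⟨x, _, rfl⟩, rfl⟩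
          simp [coe_diagGL, Matrix.diagonal_apply_ne _ hij])
        simpa using this
    have hdet : IsUnit (A : Matrix (Fin d) (Fin d) Qbar).det :=
      (Matrix.isUnit_iff_isUnit_det _).1 A.isUnit
    rw [hoff, Matrix.det_diagonal] at hdet
    have hne : ∀ i, (A : Matrix (Fin d) (Fin d) Qbar) i i ≠ 0 := fun i =>
      Finset.prod_ne_zero_iff.1 hdet.ne_zero i (Finset.mem_univ i)
    refine ⟨fun i => Units.mk0 _ (hne i), fun v hv => ?_, hoff⟩
    have h1 := hA (∏ i, X (i, i) ^ (v i).toNat - ∏ i, X (i, i) ^ (-v i).toNat) (by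
      rintro _ ⟨_, ⟨x, hx, rfl⟩, rfl⟩
      have hxv : torusChar x v = 0 := torusChar_closure_eq_zero ((hg v).1 hv) hx
      have h2 : ∏ i, x i ^ v i = 1 := hxv
      have h3 : ∏ i, (x i) ^ (v i).toNat = ∏ i, (x i) ^ (-v i).toNat := by
        rw [← div_eq_one, ← Finset.prod_div_distrib, ← h2]
        refine Finset.prod_congr rfl fun i _ => ?_
        rw [← zpow_natCast, ← zpow_natCast, div_eq_mul_inv, ← _root_.zpow_sub, Int.toNat_sub_toNat_neg]
      have h4 := congrArg (fun u : Qbarˣ => (u : Qbar)) h3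
      simp only [Units.coe_prod, Units.val_pow_eq_pow_val] at h4
      simp [coe_diagGL, h4])
    simp only [map_sub, map_prod, map_pow, eval_X, sub_eq_zero] at h1
    have h3 : ∏ i, (Units.mk0 _ (hne i)) ^ (v i).toNat =
        ∏ i, (Units.mk0 _ (hne i)) ^ (-v i).toNat := by
      apply Units.ext
      simpa only [Units.coe_prod, Units.val_pow_eq_pow_val, Units.val_mk0] using h1
    rw [← div_eq_one, ← Finset.prod_div_distrib] at h3
    rw [← h3]
    refine Finset.prod_congr rfl fun i _ => ?_
    rw [← zpow_natCast, ← zpow_natCast, div_eq_mul_inv, ← _root_.zpow_sub, Int.toNat_sub_toNat_neg]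
  · rintro ⟨x, hx, hA⟩ p hp
    rw [hA, ← eval_diagonal]
    refine eval_eq_zero_of_mem_HLat (Subgroup.closure (Set.range g)) _ (fun y hy => ?_) Λ
      (fun α _ β _ h => (hg _).2 fun j => h _ (Subgroup.subset_closure ⟨j, rfl⟩)) hx
    rw [eval_diagonal]
    exact hp _ ⟨diagGL y, ⟨y, hy, rfl⟩, rfl⟩

lemma isSemisimple_toLin'_of_isSemisimpleM {d : ℕ} {M : Matrix (Fin d) (Fin d) Qbar}
    (hM : IsSemisimpleM M) : Module.End.IsSemisimple (Matrix.toLin' M) := by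
  classical
  obtain ⟨P, D, rfl⟩ := hM
  let p : Polynomial Qbar := ∏ c ∈ Finset.univ.image D, (Polynomial.X - Polynomial.C c)
  have hp : Squarefree p := by
    apply Polynomial.Separable.squarefree
    exact Polynomial.separable_prod_X_sub_C_iff'.2 fun x _ y _ h => h
  refine Module.End.isSemisimple_of_squarefree_aeval_eq_zero hp ?_
  have h1 : Matrix.toLin' ((P⁻¹).val * Matrix.diagonal D *
      P.val) =
      Matrix.toLinAlgEquiv' ((P⁻¹).val * Matrix.diagonal D *
      P.val) := rfl
  rw [h1, Polynomial.aeval_algHom_apply]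
  have h2 : Polynomial.aeval ((P⁻¹).val * Matrix.diagonal D *
      P.val) p =
      (P⁻¹).val * Polynomial.aeval (Matrix.diagonal D) p *
      P.val := by
    induction p using Polynomial.induction_on' with
    | add p q hp hq => simp only [map_add, hp, hq, mul_add, add_mul]
    | monomial n a =>
      rw [Polynomial.aeval_monomial, Polynomial.aeval_monomial, Units.conj_pow']
      simp only [Algebra.algebraMap_eq_smul_one, smul_mul_assoc, one_mul, mul_smul_comm]
  have h3 : Polynomial.aeval (Matrix.diagonal D) p = 0 := by
    have : Polynomial.aeval (Matrix.diagonal D) p =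
        Matrix.diagonal (Polynomial.aeval D p) :=
      Polynomial.aeval_algHom_apply (Matrix.diagonalAlgHom Qbar) D p
    rw [this]
    have : Polynomial.aeval D p = 0 := by
      funext i
      rw [Polynomial.aeval_pi_apply]
      simp only [p, map_prod, Pi.zero_apply]
      exact Finset.prod_eq_zero (Finset.mem_image_of_mem D (Finset.mem_univ i)) (by simp)
    rw [this]
    exact Matrix.diagonal_zero
  rw [h2, h3]
  simp

lemma exists_simultaneous_diagonalization {d : ℕ} {ι : Type*} (M : ι → GL (Fin d) Qbar)
    (hcomm : ∀ i j, Commute (M i) (M j))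
    (hss : ∀ i, IsSemisimpleM (M i : Matrix (Fin d) (Fin d) Qbar)) :
    ∃ (P : GL (Fin d) Qbar) (g : ι → Fin d → Qbarˣ), ∀ j, M j = P * diagGL (g j) * P⁻¹ := by
  let F : ι → Module.End Qbar (Fin d → Qbar) := fun i => Matrix.toLin' (M i).val
  have htop := Module.End.iSup_iInf_maxGenEigenspace_eq_top_of_iSup_maxGenEigenspace_eq_top_of_commute
    F (fun i j _ => by
      have h := congrArg Units.val (hcomm i j).eq
      rw [Units.val_mul, Units.val_mul] at h
      change Matrix.toLin' _ * Matrix.toLin' _ = Matrix.toLin' _ * Matrix.toLin' _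
      rw [Module.End.mul_eq_comp, Module.End.mul_eq_comp, ← Matrix.toLin'_mul, ← Matrix.toLin'_mul,
        h])
    (fun i => Module.End.iSup_maxGenEigenspace_eq_top _)
  let U : Set (Fin d → Qbar) := {v | ∃ χ : ι → Qbar, ∀ i, (M i).val *ᵥ v = χ i • v}
  have hU : ⊤ ≤ Submodule.span Qbar U := by
    rw [← htop, iSup_le_iff]
    intro χ v hv
    refine Submodule.subset_span ⟨χ, fun i => ?_⟩
    have h1 := (Submodule.mem_iInf _).1 hv i
    rw [(isSemisimple_toLin'_of_isSemisimpleM (hss i)).isFinitelySemisimple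
      |>.maxGenEigenspace_eq_eigenspace, Module.End.mem_eigenspace_iff] at h1
    exact h1
  let b₀ := Module.Basis.ofSpan hU
  have hb₀ : ∀ k, b₀ k ∈ U := fun k => Module.Basis.ofSpan_subset hU ⟨k, rfl⟩
  let b := b₀.reindex (b₀.indexEquiv (Pi.basisFun Qbar (Fin d)))
  have hb : ∀ k, b k ∈ U := fun k => by
    rw [Module.Basis.reindex_apply]; exact hb₀ _
  choose χ hχ using hb
  let Pm := (Pi.basisFun Qbar (Fin d)).toMatrix b
  have hPm : IsUnit Pm :=
    IsUnit.of_mul_eq_one _ ((Pi.basisFun Qbar (Fin d)).toMatrix_mul_toMatrix_flip b)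
  obtain ⟨P, hP⟩ := hPm
  have hMP : ∀ j, (M j).val * P.val = P.val * Matrix.diagonal (fun k => χ k j) := by
    intro j
    ext i k
    rw [hP, Matrix.mul_diagonal]
    have h1 := congrFun (hχ k j) i
    simp only [Pi.smul_apply, smul_eq_mul] at h1
    rw [mul_comm]
    exact h1
  have hdiag : ∀ j, Matrix.diagonal (fun k => χ k j) = (P⁻¹ * M j * P).val := by
    intro j
    rw [Units.val_mul, Units.val_mul, mul_assoc, hMP, ← mul_assoc, ← Units.val_mul]
    simp
  have hne : ∀ j k, χ k j ≠ 0 := by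
    intro j k
    have hdet : IsUnit (Matrix.diagonal (fun k => χ k j)).det := by
      rw [hdiag]
      exact (Matrix.isUnit_iff_isUnit_det _).1 (Units.isUnit _)
    rw [Matrix.det_diagonal] at hdet
    exact Finset.prod_ne_zero_iff.1 hdet.ne_zero k (Finset.mem_univ k)
  refine ⟨P, fun j k => Units.mk0 _ (hne j k), fun j => ?_⟩
  have h1 : diagGL (fun k => Units.mk0 _ (hne j k)) = P⁻¹ * M j * P := Units.ext (hdiag j)
  rw [h1]
  group

end Matrices

section Degree

lemma totalDegree_aeval_le {σ τ R S : Type*} [CommSemiring R] [CommSemiring S] [Algebra R S]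
    (g : σ → MvPolynomial τ S) (hg : ∀ i, (g i).totalDegree ≤ 1) (p : MvPolynomial σ R) :
    (aeval g p).totalDegree ≤ p.totalDegree := by
  rw [MvPolynomial.aeval_def, MvPolynomial.eval₂_eq]
  refine (MvPolynomial.totalDegree_finsetSum _ _).trans (Finset.sup_le fun α hα => ?_)
  refine (MvPolynomial.totalDegree_mul _ _).trans ?_
  rw [MvPolynomial.algebraMap_apply, MvPolynomial.totalDegree_C, zero_add]
  refine (MvPolynomial.totalDegree_finsetProd _ _).trans ?_
  refine le_trans (Finset.sum_le_sum fun i _ => ?_) (MvPolynomial.le_totalDegree hα)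
  exact (MvPolynomial.totalDegree_pow _ _).trans (by
    simpa using Nat.mul_le_mul_left (α i) (hg i))

/-- The restriction of a polynomial in the matrix entries to a conjugate of the diagonal
matrices. -/
def diagRestrict {d : ℕ} (P : GL (Fin d) Qbar) (p : MvPolynomial (Fin d × Fin d) ℚ) :
    MvPolynomial (Fin d) Qbar :=
  aeval (fun ij : Fin d × Fin d =>
    ∑ k, MvPolynomial.C (P.val ij.1 k * P⁻¹.val k ij.2) * (X k : MvPolynomial (Fin d) Qbar)) p

lemma totalDegree_diagRestrict_le {d : ℕ} (P : GL (Fin d) Qbar)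
    (p : MvPolynomial (Fin d × Fin d) ℚ) : (diagRestrict P p).totalDegree ≤ p.totalDegree := by
  refine totalDegree_aeval_le _ (fun ij => ?_) p
  refine (MvPolynomial.totalDegree_finsetSum _ _).trans (Finset.sup_le fun k _ => ?_)
  refine (MvPolynomial.totalDegree_mul _ _).trans ?_
  rw [MvPolynomial.totalDegree_C, MvPolynomial.totalDegree_X]

lemma eval_diagRestrict {d : ℕ} (P : GL (Fin d) Qbar) (p : MvPolynomial (Fin d × Fin d) ℚ)
    (x : Fin d → Qbarˣ) :
    eval (fun i => (x i : Qbar)) (diagRestrict P p) =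
      aeval (fun ij : Fin d × Fin d => (P * diagGL x * P⁻¹ : GL (Fin d) Qbar).val ij.1 ij.2) p := by
  have h : ∀ q : MvPolynomial (Fin d) Qbar, eval (fun i => (x i : Qbar)) q =
      ((aeval (fun i => (x i : Qbar)) : MvPolynomial (Fin d) Qbar →ₐ[Qbar] Qbar).restrictScalars ℚ)
        q := fun q => rfl
  rw [h, diagRestrict, MvPolynomial.comp_aeval_apply]
  congr 2
  funext ij
  rw [← h, Units.val_mul, Units.val_mul, coe_diagGL, Matrix.mul_apply]
  simp only [Matrix.mul_diagonal, map_sum, map_mul, eval_C, eval_X]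
  exact Finset.sum_congr rfl fun k _ => by ring

end Degree

/-- If `H_Λ` is cut out in the torus by polynomials of degree at most `b`, then `Λ` is generated by
vectors of supremum norm at most `b`. -/
lemma exists_bounded_generators {d b : ℕ} {ι : Type*} (q : ι → MvPolynomial (Fin d) Qbar)
    (hq : ∀ i, (q i).totalDegree ≤ b) (Λ : Submodule ℤ (Fin d → ℤ))
    (h : ∀ x : Fin d → Qbarˣ, x ∈ HLat Λ ↔ ∀ i, eval (fun k => (x k : Qbar)) (q i) = 0) :
    ∃ gens : Set (Fin d → ℤ), (∀ w ∈ gens, ∀ i, |w i| ≤ (b : ℤ)) ∧ Λ = Submodule.span ℤ gens := by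
  let gens : Set (Fin d → ℤ) := {w | w ∈ Λ ∧ ∃ i, ∃ α ∈ (q i).support, ∃ β ∈ (q i).support,
    w = expVec α - expVec β}
  have hbound : ∀ i, ∀ α ∈ (q i).support, ∀ k, α k ≤ b := fun i α hα k =>
    ((MvPolynomial.monomial_le_degreeOf k hα).trans
      (MvPolynomial.degreeOf_le_totalDegree _ _)).trans (hq i)
  let G : Subgroup (Fin d → Qbarˣ) :=
    { carrier := HLat Λ
      one_mem' := fun v _ => by simp
      mul_mem' := fun {x y} hx hy v hv => by
        simp [mul_zpow, Finset.prod_mul_distrib, hx v hv, hy v hv]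
      inv_mem' := fun {x} hx v hv => by simp [hx v hv] }
  refine ⟨gens, ?_, le_antisymm (fun v hv => ?_) (Submodule.span_le.2 fun w hw => hw.1)⟩
  · rintro w ⟨_, i, α, hα, β, hβ, rfl⟩ k
    have h1 := hbound i α hα k
    have h2 := hbound i β hβ k
    simp only [Pi.sub_apply, expVec]
    rw [abs_le]
    omega
  · refine mem_of_forall_mem_HLat fun x hx => ?_
    refine (h x).2 (fun i => ?_) v hv
    refine eval_eq_zero_of_mem_HLat G (q i) (fun y hy => (h y).1 hy i) _
      (fun α hα β hβ hαβ => ?_) hx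
    exact Submodule.subset_span ⟨mem_of_forall_mem_HLat hαβ, i, α, hα, β, hβ, rfl⟩

/-- Group determination for commuting semisimple matrices: `Z` is the topological
closure of a group generated by `s` pairwise commuting semisimple matrices iff, up to
conjugation, it is `{Δ(g) : g ∈ H_Λ}` for a lattice `Λ` with bounded generators whose
quotient has torsion subgroup generated by at most `s` elements. -/
theorem stmt14 (d s m b : ℕ) (hd : 1 ≤ d) (hs : 1 ≤ s) (hb : 1 ≤ b)
    (f : Fin m → MvPolynomial (Fin d × Fin d) ℚ)
    (hdeg : ∀ i, (f i).totalDegree ≤ b)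
    (Z : Set (GL (Fin d) Qbar))
    (hZ : Z = {A : GL (Fin d) Qbar | ∀ i,
      aeval (fun ij : Fin d × Fin d => (A : Matrix (Fin d) (Fin d) Qbar) ij.1 ij.2)
        (f i) = 0}) :
    (∃ M : Fin s → GL (Fin d) Qbar, (∀ i j, Commute (M i) (M j)) ∧
      (∀ i, IsSemisimpleM ((M i : Matrix (Fin d) (Fin d) Qbar))) ∧
      Z = topcl (Set.range M)) ↔
    (∃ (P : GL (Fin d) Qbar) (Λ : Submodule ℤ (Fin d → ℤ)),
      (∃ gens : Set (Fin d → ℤ), (∀ w ∈ gens, ∀ i, |w i| ≤ (b : ℤ)) ∧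
        Λ = Submodule.span ℤ gens) ∧
      (∃ t : Fin s → Submodule.torsion ℤ ((Fin d → ℤ) ⧸ Λ),
        Submodule.span ℤ (Set.range t) = ⊤) ∧
      {A : GL (Fin d) Qbar | ∃ B ∈ Z, A = P⁻¹ * B * P} =
        {A : GL (Fin d) Qbar | ∃ g ∈ HLat Λ,
          (A : Matrix (Fin d) (Fin d) Qbar) = Matrix.diagonal (fun i => (g i : Qbar))}) := by
  have hconj : ∀ (P : GL (Fin d) Qbar) (N : Fin s → GL (Fin d) Qbar),
      {A : GL (Fin d) Qbar | ∃ B ∈ topcl (Set.range fun j => P * N j * P⁻¹), A = P⁻¹ * B * P} =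
        topcl (Set.range N) := by
    intro P N
    ext A
    constructor
    · rintro ⟨B, hB, rfl⟩
      rw [← mem_topcl_conj_iff N P]
      convert hB using 1
      group
    · intro hA
      exact ⟨_, (mem_topcl_conj_iff N P A).2 hA, by group⟩
  constructor
  · rintro ⟨M, hcomm, hss, hZM⟩
    obtain ⟨P, g, hPg⟩ := exists_simultaneous_diagonalization M hcomm hss
    let Λ : Submodule ℤ (Fin d → ℤ) := ⨅ j, LinearMap.ker (torusChar (g j)).toIntLinearMap
    have hΛ : ∀ v, v ∈ Λ ↔ ∀ j, torusChar (g j) v = 0 := fun v => by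
      simp only [Λ, Submodule.mem_iInf, LinearMap.mem_ker]
      rfl
    have hset : {A : GL (Fin d) Qbar | ∃ B ∈ Z, A = P⁻¹ * B * P} =
        {A : GL (Fin d) Qbar | ∃ g ∈ HLat Λ,
          (A : Matrix (Fin d) (Fin d) Qbar) = Matrix.diagonal (fun i => (g i : Qbar))} := by
      rw [hZM, (funext hPg : M = _), hconj, topcl_diagGL g Λ hΛ]
    refine ⟨P, Λ, ?_, exists_generators_torsion_quotient Λ g hΛ, hset⟩
    refine exists_bounded_generators (fun i => diagRestrict P (f i))
      (fun i => (totalDegree_diagRestrict_le P (f i)).trans (hdeg i)) Λ fun x => ?_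
    have h1 : x ∈ HLat Λ ↔ diagGL x ∈ {A : GL (Fin d) Qbar | ∃ g ∈ HLat Λ,
        (A : Matrix (Fin d) (Fin d) Qbar) = Matrix.diagonal (fun i => (g i : Qbar))} := by
      refine ⟨fun hx => ⟨x, hx, rfl⟩, ?_⟩
      rintro ⟨y, hy, hxy⟩
      have : x = y := funext fun i => Units.ext (congrFun (Matrix.diagonal_injective hxy) i)
      rwa [this]
    have h2 : diagGL x ∈ {A : GL (Fin d) Qbar | ∃ B ∈ Z, A = P⁻¹ * B * P} ↔
        P * diagGL x * P⁻¹ ∈ Z := by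
      constructor
      · rintro ⟨B, hB, hx⟩
        rw [hx]
        convert hB using 1
        group
      · intro hx
        exact ⟨_, hx, by group⟩
    rw [h1, ← hset, h2, hZ]
    simp only [eval_diagRestrict]
    rfl
  · rintro ⟨P, Λ, -, ⟨t, ht⟩, hset⟩
    obtain ⟨g, hg⟩ := exists_points_defining_lattice hs Λ t ht
    refine ⟨fun j => P * diagGL (g j) * P⁻¹, fun i j => ?_, fun j => ?_, ?_⟩
    · have h : diagGL (g i) * diagGL (g j) = diagGL (g j) * diagGL (g i) := by
        rw [← map_mul, mul_comm, map_mul]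
      change P * diagGL (g i) * P⁻¹ * (P * diagGL (g j) * P⁻¹) =
        P * diagGL (g j) * P⁻¹ * (P * diagGL (g i) * P⁻¹)
      calc _ = P * (diagGL (g i) * diagGL (g j)) * P⁻¹ := by group
        _ = P * (diagGL (g j) * diagGL (g i)) * P⁻¹ := by rw [h]
        _ = _ := by group
    · exact ⟨P⁻¹, fun i => (g j i : Qbar), by rw [inv_inv]; rfl⟩
    · rw [← topcl_diagGL g Λ hg, ← hconj P] at hset
      ext B
      have hB : ∀ Y : Set (GL (Fin d) Qbar), B ∈ Y ↔
          P⁻¹ * B * P ∈ {A : GL (Fin d) Qbar | ∃ B ∈ Y, A = P⁻¹ * B * P} := by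
        refine fun Y => ⟨fun h => ⟨B, h, rfl⟩, ?_⟩
        rintro ⟨C, hC, h⟩
        rwa [mul_left_cancel (mul_right_cancel h)]
      rw [hB Z, hset, ← hB]
end
end

section
/- Let Z := {(x_1,x_2,x_3,x_4) ∈ ℚ̄⁴ : x_2² − x_1 − x_4 = 0 and −2x_4x_2 − 2x_3² − (1/5)x_2x_3 = 0}, let M ∈ GL_4(ℚ̄) be the matrix with rows (25,0,−1,20), (0,5,0,0), (0,−1/2,5,0), (0,0,1,5), and let v = (1,1,0,0) ∈ ℚ̄⁴. Then Z equals the Zariski closure of the orbit {Mⁿv : n ∈ ℤ}. -/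
open Matrix MvPolynomial

noncomputable section

/-- The shift operator on sequences. -/
def seqShift (K : Type*) [Field K] : Module.End K (ℕ → K) where
  toFun f n := f (n + 1)
  map_add' _ _ := rfl
  map_smul' _ _ := rfl

lemma seqShift_sub_pow_apply {K : Type*} [Field K] (μ : K) (f : K → K) (k n : ℕ) :
    ((seqShift K - μ • (1 : Module.End K (ℕ → K))) ^ k) (fun n => f n * μ ^ n) n =
      (fwdDiff 1)^[k] f n * μ ^ (n + k) := by
  induction k generalizing f n with
  | zero => simp
  | succ k ih =>
    have h : (seqShift K - μ • (1 : Module.End K (ℕ → K))) (fun n => f n * μ ^ n) =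
        μ • fun n : ℕ => fwdDiff 1 f (n : K) * μ ^ n := by
      ext n
      simp [seqShift, fwdDiff]
      ring
    rw [pow_succ, Module.End.mul_apply, h, map_smul, Pi.smul_apply, ih, Function.iterate_succ_apply,
      smul_eq_mul]
    ring

lemma poly_mul_pow_mem_maxGenEigenspace {K : Type*} [Field K] (P : Polynomial K) (μ : K) :
    (fun n : ℕ => P.eval (n : K) * μ ^ n) ∈ (seqShift K).maxGenEigenspace μ := by
  rw [Module.End.mem_maxGenEigenspace]
  refine ⟨P.natDegree + 1, funext fun n => ?_⟩
  rw [seqShift_sub_pow_apply μ (fun x => P.eval x),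
    Polynomial.fwdDiff_iter_degree_add_one_eq_zero]
  simp

/-- A bivariate polynomial vanishing at all `(n, r ^ n)`, where the powers of `r` are distinct and
nonzero, is zero. -/
lemma bivariate_eq_zero_of_evalEval_pow {K : Type*} [Field K] [CharZero K] {r : K}
    (hr0 : r ≠ 0) (hr : Function.Injective fun n : ℕ => r ^ n)
    (q : Polynomial (Polynomial K)) (hq : ∀ n : ℕ, q.evalEval (n : K) (r ^ n) = 0) : q = 0 := by
  have hind := (Module.End.independent_maxGenEigenspace (seqShift K)).comp hr
  rw [iSupIndep_iff_finsetSum_eq_zero_imp_eq_zero] at hind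
  have key := hind (Finset.range (q.natDegree + 1))
    (fun j n => (q.coeff j).eval (n : K) * (r ^ j) ^ n)
    (fun j _ => poly_mul_pow_mem_maxGenEigenspace (q.coeff j) (r ^ j)) (by
      ext n
      rw [Finset.sum_apply, Pi.zero_apply, ← hq n, Polynomial.evalEval,
        Polynomial.eval_eq_sum_range (p := q), Polynomial.eval_finsetSum]
      refine Finset.sum_congr rfl fun j _ => ?_
      simp [← pow_mul, mul_comm])
  ext1 j
  rw [Polynomial.coeff_zero]
  by_cases hj : j ∈ Finset.range (q.natDegree + 1)
  · refine Polynomial.eq_zero_of_infinite_isRoot _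
      (Set.infinite_of_injective_forall_mem (Nat.cast_injective (R := K)) fun n => ?_)
    have h := congrFun (key j hj) n
    simpa [hr0] using h
  · exact Polynomial.coeff_eq_zero_of_natDegree_lt (by simpa using hj)

/-- A parametrization of the Zariski dense subset `x 1 ≠ 0` of the variety. -/
def varietyPoint {R : Type*} [CommRing R] [Algebra ℚ R] (a m : R) : Fin 4 → R :=
  ![a ^ 4 + algebraMap ℚ R (1 / 100) * (m ^ 2 - m) * a ^ 2, a ^ 2,
    -algebraMap ℚ R (1 / 10) * m * a ^ 2, -algebraMap ℚ R (1 / 100) * (m ^ 2 - m) * a ^ 2]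

lemma eval_varietyPoint_eq_zero {K : Type*} [Field K] [CharZero K] {r : K}
    (hr0 : r ≠ 0) (hr : Function.Injective fun n : ℕ => r ^ n) (p : MvPolynomial (Fin 4) K)
    (hp : ∀ n : ℕ, eval (varietyPoint (r ^ n) (n : K)) p = 0) (a m : K) :
    eval (varietyPoint a m) p = 0 := by
  set q : Polynomial (Polynomial K) :=
    MvPolynomial.aeval
      (varietyPoint (R := Polynomial (Polynomial K)) Polynomial.X (Polynomial.C Polynomial.X)) p with hq
  have hev (a m : K) : q.evalEval m a = eval (varietyPoint a m) p := by
    rw [hq, ← Polynomial.coe_evalEvalRingHom, MvPolynomial.aeval_def, MvPolynomial.hom_eval₂]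
    have hf : (Polynomial.evalEvalRingHom m a).comp
        (algebraMap K (Polynomial (Polynomial K))) = RingHom.id K := by
      ext x
      simp [Polynomial.algebraMap_apply]
    rw [hf, ← MvPolynomial.eval₂_id]
    congr 1
    ext i
    fin_cases i <;> simp [varietyPoint]
  rw [← hev, bivariate_eq_zero_of_evalEval_pow hr0 hr q fun n => by rw [hev, hp],
    Polynomial.evalEval_zero]

/-- A univariate polynomial identity `p(f(t)) = 0` valid for `t ≠ 0` also holds at `t = 0`. -/
lemma eval_eq_zero_of_forall_ne_zero {ι K : Type*} [Field K] [Infinite K]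
    (p : MvPolynomial ι K) (f : ι → Polynomial K)
    (h : ∀ t ≠ 0, eval (fun i => (f i).eval t) p = 0) :
    eval (fun i => (f i).eval 0) p = 0 := by
  have hev (t : K) : (MvPolynomial.aeval f p).eval t = eval (fun i => (f i).eval t) p := by
    rw [← Polynomial.coe_evalRingHom, MvPolynomial.aeval_def, MvPolynomial.hom_eval₂]
    have hf : (Polynomial.evalRingHom t).comp (algebraMap K (Polynomial K)) = RingHom.id K := by
      ext x
      simp
    rw [hf, ← MvPolynomial.eval₂_id]
  have hz : MvPolynomial.aeval f p = 0 := by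
    refine Polynomial.eq_zero_of_infinite_isRoot _
      ((Set.finite_singleton (0 : K)).infinite_compl.mono fun t ht => ?_)
    rw [Set.mem_ofPred_eq, Polynomial.IsRoot, hev, h t (by simpa using ht)]
  rw [← hev, hz, Polynomial.eval_zero]

lemma zpow_mulVec_eq {d : ℕ} {K : Type*} [Field K] (M : Matrix (Fin d) (Fin d) K)
    (hM : IsUnit M.det) (w : ℤ → Fin d → K) (hw : ∀ n, M.mulVec (w n) = w (n + 1)) (n : ℤ) :
    (M ^ n).mulVec (w 0) = w n := by
  induction n using Int.induction_on with
  | zero => simp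
  | succ n ih => rw [add_comm, Matrix.zpow_one_add hM, ← Matrix.mulVec_mulVec, ih, hw, add_comm]
  | pred n ih =>
    rw [show (-(n : ℤ) - 1) = -1 + -n by ring, Matrix.zpow_add hM, ← Matrix.mulVec_mulVec, ih,
      Matrix.zpow_neg_one, show (-(n : ℤ)) = -1 + -n + 1 by ring, ← hw, Matrix.mulVec_mulVec,
      Matrix.nonsing_inv_mul _ hM, Matrix.one_mulVec]
    ring_nf

/-- The orbit of `(1, 1, 0, 0)`. -/
def orbitPoint (n : ℤ) : Fin 4 → Qbar :=
  ![25 ^ n + (1 / 100) * ((n : Qbar) ^ 2 - n) * 5 ^ n, 5 ^ n, -(1 / 10) * n * 5 ^ n,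
    -(1 / 100) * ((n : Qbar) ^ 2 - n) * 5 ^ n]

lemma zpow_mulVec_eq_orbitPoint (n : ℤ) :
    ((!![25, 0, -1, 20; 0, 5, 0, 0; 0, -1/2, 5, 0; 0, 0, 1, 5] :
      Matrix (Fin 4) (Fin 4) Qbar) ^ n).mulVec ![1, 1, 0, 0] = orbitPoint n := by
  have h0 : (![1, 1, 0, 0] : Fin 4 → Qbar) = orbitPoint 0 := by
    simp [orbitPoint]
  rw [h0]
  refine zpow_mulVec_eq _ ?_ _ (fun n => ?_) n
  · rw [isUnit_iff_ne_zero]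
    simp [Matrix.det_succ_row_zero, Fin.sum_univ_succ, Fin.succAbove]
  · ext i
    have h5 : (5 : Qbar) ^ (n + 1) = 5 ^ n * 5 := zpow_add_one₀ (by norm_num) n
    have h25 : (25 : Qbar) ^ (n + 1) = 25 ^ n * 25 := zpow_add_one₀ (by norm_num) n
    fin_cases i <;>
      simp [orbitPoint, Matrix.mulVec, dotProduct, Fin.sum_univ_succ, h5, h25] <;> ring

lemma orbitPoint_mem (n : ℤ) : orbitPoint n 1 ^ 2 - orbitPoint n 0 - orbitPoint n 3 = 0 ∧
    -2 * orbitPoint n 3 * orbitPoint n 1 - 2 * orbitPoint n 2 ^ 2 -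
      (1 / 5 : Qbar) * orbitPoint n 1 * orbitPoint n 2 = 0 := by
  have h : (25 : Qbar) ^ n = (5 ^ n) ^ 2 := by
    rw [show (25 : Qbar) = 5 * 5 by norm_num, mul_zpow, sq]
  constructor
  · simp [orbitPoint, h]
  · simp [orbitPoint]
    ring

/-- The variety `x₂² − x₁ − x₄ = 0`, `−2x₄x₂ − 2x₃² − (1/5)x₂x₃ = 0` is the orbit
closure of `(1,1,0,0)` under the given matrix. -/
theorem stmt19 :
    {x : Fin 4 → Qbar | x 1 ^ 2 - x 0 - x 3 = 0 ∧
        -2 * x 3 * x 1 - 2 * x 2 ^ 2 - (1 / 5 : Qbar) * x 1 * x 2 = 0} =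
      zcl {x : Fin 4 → Qbar | ∃ n : ℤ,
        x = ((!![25, 0, -1, 20; 0, 5, 0, 0; 0, -1/2, 5, 0; 0, 0, 1, 5] :
          Matrix (Fin 4) (Fin 4) Qbar) ^ n).mulVec ![1, 1, 0, 0]} := by
  simp only [zpow_mulVec_eq_orbitPoint]
  refine Set.Subset.antisymm ?_ ?_
  · rintro x ⟨h1, h2⟩ p hp
    obtain ⟨r, hr⟩ := IsAlgClosed.exists_pow_nat_eq (5 : Qbar) (n := 2) two_pos
    have hr0 : r ≠ 0 := by
      rintro rfl
      norm_num at hr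
    have hinj : Function.Injective fun n : ℕ => r ^ n := by
      intro m n hmn
      have h5 : (5 : Qbar) ^ m = 5 ^ n := by
        simp only at hmn
        rw [← hr, ← pow_mul, ← pow_mul, mul_comm, pow_mul, hmn, ← pow_mul, mul_comm]
      exact Nat.pow_right_injective (by norm_num : 2 ≤ 5) (by exact_mod_cast h5)
    have hvar : ∀ a m : Qbar, eval (varietyPoint a m) p = 0 :=
      eval_varietyPoint_eq_zero hr0 hinj p fun n => by
        rw [← hp _ ⟨n, rfl⟩]
        have e2 : (r ^ n) ^ 2 = 5 ^ n := by rw [← pow_mul, mul_comm, pow_mul, hr]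
        have e4 : (r ^ n) ^ 4 = 25 ^ n := by
          rw [← pow_mul, mul_comm, pow_mul, show r ^ 4 = (r ^ 2) ^ 2 by ring, hr]
          norm_num
        congr 2
        ext i
        fin_cases i <;> simp [varietyPoint, orbitPoint, e2, e4]
    by_cases hx : x 1 = 0
    · have hx2 : x 2 = 0 := by simpa [hx] using h2
      obtain ⟨b, hb⟩ := IsAlgClosed.exists_pow_nat_eq (-x 3) (n := 2) two_pos
      have h := eval_eq_zero_of_forall_ne_zero p
        ![.X ^ 4 + .C (b ^ 2) + .C (b / 10) * .X, .X ^ 2, .C b * .X,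
          -.C (b ^ 2) - .C (b / 10) * .X] (fun t ht => by
            rw [← hvar t (-10 * b / t)]
            congr 2
            ext i
            fin_cases i <;> simp [varietyPoint] <;> field_simp <;> ring)
      rw [← h]
      congr 2
      ext i
      fin_cases i
      · simp [hb]
        linear_combination -h1 + x 1 * hx
      · simp [hx]
      · simp [hx2]
      · simp [hb]
    · obtain ⟨a, ha⟩ := IsAlgClosed.exists_pow_nat_eq (x 1) (n := 2) two_pos
      rw [← hvar a (-10 * x 2 / x 1)]
      have ha4 : a ^ 4 = x 1 ^ 2 := by rw [← ha]; ring
      have h3 : x 3 = -(x 2 ^ 2 / x 1 + x 2 / 10) := by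
        field_simp
        linear_combination -5 * h2
      have h0 : x 0 = x 1 ^ 2 + (x 2 ^ 2 / x 1 + x 2 / 10) := by
        linear_combination -h1 - h3
      congr 2
      ext i
      fin_cases i
      · simp [varietyPoint, ha, ha4, h0]
        field_simp
        ring
      · simp [varietyPoint, ha]
      · simp [varietyPoint, ha]
        field_simp
      · simp [varietyPoint, ha, h3]
        field_simp
        ring
  · intro x hx
    constructor
    · have h := hx (X 1 ^ 2 - X 0 - X 3) (by
        rintro _ ⟨n, rfl⟩
        simpa using (orbitPoint_mem n).1)
      simpa using h
    · have h := hx (C (-2) * X 3 * X 1 - C 2 * X 2 ^ 2 - C (1 / 5) * X 1 * X 2) (by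
        rintro _ ⟨n, rfl⟩
        simp only [map_sub, map_mul, map_pow, eval_C, eval_X]
        exact (orbitPoint_mem n).2)
      simpa only [map_sub, map_mul, map_pow, eval_C, eval_X] using h
end
end
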